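/- The assignment t ↦ ρ(t), σ_i ↦ ρ(σ_i) extends to a group homomorphism from the mixed braid group on one strand B_{1,n} to GL_n(ℤ[a^{±1}, b^{±1}]). -/

import Mathlib

open LaurentPolynomial Matrix

/-- The ring `ℤ[a^{±1}, b^{±1}]`, realized as iterated Laurent polynomials. -/
noncomputable abbrev R2 : Type := LaurentPolynomial (LaurentPolynomial ℤ)

/-- The variable `a`. -/
noncomputable def a : R2 := LaurentPolynomial.C (T 1)

/-- The variable `b`. -/
noncomputable def b : R2 := T 1

/-- The matrix `ρ(t)` of size `n+2`: the identity matrix except that its `(1,1)` entry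
is `a*b` and its `(1,2)` entry is `1 - b`. -/
noncomputable def ρt (n : ℕ) : Matrix (Fin (n+2)) (Fin (n+2)) R2 :=
  fun k l => if k = 0 then (if l = 0 then a * b else if l = 1 then 1 - b else 0)
             else if k = l then 1 else 0

/-- The matrix `ρ(σ_i)` of size `n+2`, for `i : Fin (n+1)` (0-indexed; `i` corresponds
to the generator `σ_{i+1}` in the 1-indexed notation of the paper): the identity matrix
except that row `i+1` (0-indexed `i.succ`) has entry `a` in column `i`, entry `-a` in
column `i+1`, and entry `1` in column `i+2` (when it exists). -/
noncomputable def ρσ (n : ℕ) (i : Fin (n+1)) : Matrix (Fin (n+2)) (Fin (n+2)) R2 :=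
  fun k l => if k = i.succ then
      (if l = i.castSucc then a else if l = i.succ then -a
        else if (l : ℕ) = (i : ℕ) + 2 then 1 else 0)
    else if k = l then 1 else 0

/-- The generators of the mixed braid group `B_{1,n+2}` on one strand: `t` and
`σ_1, …, σ_{n+1}` (here `Gen.s i`, `i : Fin (n+1)`, stands for `σ_{i+1}`). -/
inductive Gen (n : ℕ) where
  | t : Gen n
  | s : Fin (n+1) → Gen n

open FreeGroup in
/-- The defining relations of the mixed braid group `B_{1,n+2}` on one strand:
`σ_i σ_j = σ_j σ_i` for `|i-j| > 1`; `σ_i σ_{i+1} σ_i = σ_{i+1} σ_i σ_{i+1}`;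
`t σ_i = σ_i t` for `i ≥ 2`; and `t σ_1 t σ_1 = σ_1 t σ_1 t`. -/
def mixedRels (n : ℕ) : Set (FreeGroup (Gen n)) :=
  {r | (∃ i j : Fin (n+1), (i : ℕ) + 1 < (j : ℕ) ∧
          r = of (Gen.s i) * of (Gen.s j) * (of (Gen.s i))⁻¹ * (of (Gen.s j))⁻¹) ∨
       (∃ i j : Fin (n+1), (j : ℕ) = (i : ℕ) + 1 ∧
          r = of (Gen.s i) * of (Gen.s j) * of (Gen.s i) *
                (of (Gen.s j) * of (Gen.s i) * of (Gen.s j))⁻¹) ∨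
       (∃ i : Fin (n+1), 1 ≤ (i : ℕ) ∧
          r = of Gen.t * of (Gen.s i) * (of (Gen.s i) * of Gen.t)⁻¹) ∨
       r = of Gen.t * of (Gen.s 0) * of Gen.t * of (Gen.s 0) *
             (of (Gen.s 0) * of Gen.t * of (Gen.s 0) * of Gen.t)⁻¹}

/-- The mixed braid group `B_{1,n+2}` on one strand, as a presented group. -/
abbrev MixedBraidGroup (n : ℕ) := PresentedGroup (mixedRels n)

/-- Extension of a vector indexed by `Fin m` by zero to all natural numbers. -/
noncomputable def extendZero {m : ℕ} (v : Fin m → R2) (k : ℕ) : R2 :=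
  if h : k < m then v ⟨k, h⟩ else 0

lemma extendZero_val {m : ℕ} (v : Fin m → R2) (k : Fin m) : extendZero v k = v k := by
  simp [extendZero]

lemma extendZero_of_le {m : ℕ} (v : Fin m → R2) {k : ℕ} (h : m ≤ k) : extendZero v k = 0 := by
  simp [extendZero, h]

lemma matrix_eq_of_extendZero_mulVec {m : ℕ} {A B : Matrix (Fin m) (Fin m) R2}
    (h : ∀ v k, extendZero (A *ᵥ v) k = extendZero (B *ᵥ v) k) : A = B := by
  refine Matrix.mulVec_injective (funext fun v => funext fun k => ?_)
  simpa only [extendZero_val] using h v k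

lemma extendZero_ρt_mulVec (n : ℕ) (v : Fin (n+2) → R2) (k : ℕ) :
    extendZero (ρt n *ᵥ v) k =
      if k = 0 then a * b * extendZero v 0 + (1 - b) * extendZero v 1 else extendZero v k := by
  by_cases hk : k < n + 2
  · lift k to Fin (n+2) using hk
    have h0 : extendZero v 0 = v 0 := extendZero_val v 0
    have h1 : extendZero v 1 = v 1 := extendZero_val v 1
    rw [extendZero_val, extendZero_val, h0, h1]
    by_cases h : k = 0
    · subst h
      have hrow : ρt n 0 = Pi.single 0 (a * b) + Pi.single 1 (1 - b) := by
        ext1 l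
        by_cases hl : l = 0
        · subst hl; simp [ρt]
        · by_cases hl' : l = 1 <;> simp [ρt, hl, hl']
      simp only [Matrix.mulVec, hrow, add_dotProduct, single_dotProduct, Fin.val_zero, if_true]
    · have hrow : ρt n k = Pi.single k 1 := by
        ext1 l
        simp [ρt, h, Pi.single_apply, eq_comm]
      simp [Matrix.mulVec, hrow, h]
  · rw [extendZero_of_le _ (not_lt.mp hk), extendZero_of_le _ (not_lt.mp hk), if_neg (by omega)]

lemma extendZero_ρσ_mulVec (n : ℕ) (i : Fin (n+1)) (v : Fin (n+2) → R2) (k : ℕ) :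
    extendZero (ρσ n i *ᵥ v) k =
      if k = (i : ℕ) + 1 then
        a * extendZero v i - a * extendZero v (i + 1) + extendZero v (i + 2)
      else extendZero v k := by
  by_cases hk : k < n + 2
  · lift k to Fin (n+2) using hk
    have h0 : extendZero v i = v i.castSucc := extendZero_val v i.castSucc
    have h1 : extendZero v (i + 1) = v i.succ := extendZero_val v i.succ
    rw [extendZero_val, extendZero_val, h0, h1]
    by_cases h : k = i.succ
    · subst h
      have hrow : ρσ n i i.succ = Pi.single i.castSucc a + Pi.single i.succ (-a) +
          fun l : Fin (n+2) => if (l : ℕ) = (i : ℕ) + 2 then (1 : R2) else 0 := by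
        ext1 l
        simp only [ρσ, Pi.add_apply, Pi.single_apply, Fin.ext_iff, Fin.val_succ, Fin.val_castSucc]
        split_ifs <;> first | omega | simp
      have hlast : (fun l : Fin (n+2) => if (l : ℕ) = (i : ℕ) + 2 then (1 : R2) else 0) ⬝ᵥ v =
          extendZero v (i + 2) := by
        by_cases hi : (i : ℕ) + 2 < n + 2
        · have : (fun l : Fin (n+2) => if (l : ℕ) = (i : ℕ) + 2 then (1 : R2) else 0) =
              Pi.single ⟨i + 2, hi⟩ 1 := by
            ext1 l
            simp [Pi.single_apply, Fin.ext_iff]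
          rw [this, single_one_dotProduct, extendZero, dif_pos hi]
        · rw [extendZero_of_le _ (by omega)]
          refine Finset.sum_eq_zero fun l _ => ?_
          simp only [if_neg (show ¬(l : ℕ) = i + 2 by omega), zero_mul]
      simp only [Matrix.mulVec, hrow, add_dotProduct, hlast, single_dotProduct, Fin.val_succ,
        if_true]
      ring
    · have hrow : ρσ n i k = Pi.single k 1 := by
        ext1 l
        simp [ρσ, h, Pi.single_apply, eq_comm]
      have h' : (k : ℕ) ≠ i + 1 := fun e => h (Fin.ext e)
      simp [Matrix.mulVec, hrow, h']
  · rw [extendZero_of_le _ (not_lt.mp hk), extendZero_of_le _ (not_lt.mp hk), if_neg (by omega)]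

lemma isUnit_a : IsUnit a :=
  IsUnit.map LaurentPolynomial.C (LaurentPolynomial.isUnit_T 1)

lemma isUnit_b : IsUnit b :=
  LaurentPolynomial.isUnit_T 1

lemma isUnit_ρt (n : ℕ) : IsUnit (ρt n) := by
  rw [← Matrix.mulVec_surjective_iff_isUnit]
  intro w
  obtain ⟨c, hc⟩ := (isUnit_a.mul isUnit_b).exists_right_inv
  refine ⟨fun k => if k = 0 then c * (w 0 - (1 - b) * w 1) else w k, funext fun k => ?_⟩
  rw [← extendZero_val (_ *ᵥ _), extendZero_ρt_mulVec]
  by_cases hk : k = 0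
  · subst hk
    simp [extendZero]
    linear_combination (w 0 - (1 - b) * w 1) * hc
  · simp [extendZero, hk]

lemma isUnit_ρσ (n : ℕ) (i : Fin (n+1)) : IsUnit (ρσ n i) := by
  rw [← Matrix.mulVec_surjective_iff_isUnit]
  intro w
  obtain ⟨c, hc⟩ := isUnit_a.exists_right_inv
  let v : Fin (n+2) → R2 := fun k => if (k : ℕ) = i + 1 then
    extendZero w i + c * (extendZero w (i + 2) - extendZero w (i + 1)) else w k
  have hv (m : ℕ) (hm : m ≠ i + 1) : extendZero v m = extendZero w m := by
    simp [extendZero, v, hm]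
  have hvi : extendZero v (i + 1) =
      extendZero w i + c * (extendZero w (i + 2) - extendZero w (i + 1)) :=
    (extendZero_val v i.succ).trans (if_pos rfl)
  refine ⟨v, funext fun k => ?_⟩
  rw [← extendZero_val (_ *ᵥ _), extendZero_ρσ_mulVec, ← extendZero_val w k]
  split_ifs with hk
  · rw [hk, hvi, hv _ (by omega), hv _ (by omega)]
    linear_combination (extendZero w (i + 1) - extendZero w (i + 2)) * hc
  · exact hv _ hk

lemma ρσ_comm (n : ℕ) {i j : Fin (n+1)} (h : (i : ℕ) + 1 < j) :
    ρσ n i * ρσ n j = ρσ n j * ρσ n i := by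
  refine matrix_eq_of_extendZero_mulVec fun v k => ?_
  simp only [← Matrix.mulVec_mulVec, extendZero_ρσ_mulVec]
  grind

lemma ρσ_braid (n : ℕ) {i j : Fin (n+1)} (h : (j : ℕ) = i + 1) :
    ρσ n i * ρσ n j * ρσ n i = ρσ n j * ρσ n i * ρσ n j := by
  refine matrix_eq_of_extendZero_mulVec fun v k => ?_
  simp only [← Matrix.mulVec_mulVec, extendZero_ρσ_mulVec, h]
  grind

lemma ρt_mul_ρσ_comm (n : ℕ) {i : Fin (n+1)} (h : 1 ≤ (i : ℕ)) :
    ρt n * ρσ n i = ρσ n i * ρt n := by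
  refine matrix_eq_of_extendZero_mulVec fun v k => ?_
  simp only [← Matrix.mulVec_mulVec, extendZero_ρσ_mulVec, extendZero_ρt_mulVec]
  grind

lemma ρt_ρσ_zero_braid (n : ℕ) :
    ρt n * ρσ n 0 * ρt n * ρσ n 0 = ρσ n 0 * ρt n * ρσ n 0 * ρt n := by
  refine matrix_eq_of_extendZero_mulVec fun v k => ?_
  simp only [← Matrix.mulVec_mulVec, extendZero_ρσ_mulVec, extendZero_ρt_mulVec, Fin.val_zero]
  grind

/-- The images of the generators of the mixed braid group, as invertible matrices. -/
noncomputable def burauGen (n : ℕ) : Gen n → GL (Fin (n+2)) R2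
  | Gen.t => (isUnit_ρt n).unit
  | Gen.s i => (isUnit_ρσ n i).unit

lemma lift_burauGen_eq_one (n : ℕ) : ∀ r ∈ mixedRels n, FreeGroup.lift (burauGen n) r = 1 := by
  rintro r (⟨i, j, h, rfl⟩ | ⟨i, j, h, rfl⟩ | ⟨i, h, rfl⟩ | rfl) <;>
    simp only [map_mul, map_inv, FreeGroup.lift_apply_of]
  · rw [mul_inv_eq_one, mul_inv_eq_iff_eq_mul]
    exact Units.ext (ρσ_comm n h)
  · rw [mul_inv_eq_one]
    exact Units.ext (ρσ_braid n h)
  · rw [mul_inv_eq_one]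
    exact Units.ext (ρt_mul_ρσ_comm n h)
  · rw [mul_inv_eq_one]
    exact Units.ext (ρt_ρσ_zero_braid n)

/-- The assignment `t ↦ ρ(t)`, `σ_i ↦ ρ(σ_i)` extends to a group homomorphism from the
mixed braid group on one strand `B_{1,n}` (here with `n+2` in place of `n`, so `n ≥ 2`)
to `GL_n(ℤ[a^{±1}, b^{±1}])`. -/
theorem exists_burau_hom (n : ℕ) :
    ∃ φ : MixedBraidGroup n →* GL (Fin (n+2)) R2,
      ((φ (PresentedGroup.of Gen.t) : Matrix (Fin (n+2)) (Fin (n+2)) R2) = ρt n) ∧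
      ∀ i : Fin (n+1),
        ((φ (PresentedGroup.of (Gen.s i)) : Matrix (Fin (n+2)) (Fin (n+2)) R2) = ρσ n i) := by
  refine ⟨PresentedGroup.toGroup (lift_burauGen_eq_one n), ?_, fun i => ?_⟩
  · rw [PresentedGroup.toGroup.of]
    rfl
  · rw [PresentedGroup.toGroup.of]
    rfl
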